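/- arXiv:2102.03090 — 3 statements merged into one kernel-verified Lean document; each statement's English description precedes it below -/
import Mathlib

section
/- Let ε > 0 and Λ > 0 be real constants with Λ² > 4ε, let v be a real number with v² = Λ²/(Λ² − 4ε), and set A = 12v²/Λ². Then the travelling wave u(x,t) = A · sech²((x − v t)/Λ) is an exact solution of the regularised Boussinesq equation u_tt − u_xx = ε[ (1/2)(u²)_xx + u_ttxx ] at every point (x,t) ∈ ℝ². -/
/-- Partial derivative in the first variable. -/
noncomputable def pd1 (f : ℝ → ℝ → ℝ) (x y : ℝ) : ℝ := deriv (fun x' => f x' y) x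

/-- Partial derivative in the second variable. -/
noncomputable def pd2 (f : ℝ → ℝ → ℝ) (x y : ℝ) : ℝ := deriv (fun y' => f x y') y

/-- The first derivative of a power of the hyperbolic secant. -/
lemma hasDerivAt_sech_pow (n : ℕ) (y : ℝ) :
    HasDerivAt (fun y => (1 / Real.cosh y) ^ n)
      (-n * ((1 / Real.cosh y) ^ n * (Real.sinh y / Real.cosh y))) y := by
  have hc := (Real.cosh_pos y).ne'
  have h := ((Real.hasDerivAt_cosh y).inv hc).pow n
  simp only [one_div]
  refine h.congr_deriv ?_
  cases n with
  | zero => simp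
  | succ k =>
    simp only [Nat.add_sub_cancel, Pi.inv_apply]
    rw [pow_succ (Real.cosh y)⁻¹ k]
    field_simp

/-- The second derivative of a power of the hyperbolic secant. -/
lemma hasDerivAt_deriv_sech_pow (n : ℕ) (y : ℝ) :
    HasDerivAt (fun y => -(n : ℝ) * ((1 / Real.cosh y) ^ n * (Real.sinh y / Real.cosh y)))
      (n ^ 2 * (1 / Real.cosh y) ^ n - n * (n + 1) * (1 / Real.cosh y) ^ (n + 2)) y := by
  have hc := (Real.cosh_pos y).ne'
  have h := ((hasDerivAt_sech_pow n y).mul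
    ((Real.hasDerivAt_sinh y).div (Real.hasDerivAt_cosh y) hc)).const_mul (-(n : ℝ))
  refine h.congr_deriv ?_
  rw [Pi.div_apply, pow_add (1 / Real.cosh y) n 2]
  field_simp
  rw [Real.sinh_sq y]
  ring

lemma pd1_travelling {g g₁ : ℝ → ℝ} (hg : ∀ y, HasDerivAt g (g₁ y) y) (v Λ : ℝ) :
    pd1 (fun x t => g ((x - v * t) / Λ)) = fun x t => g₁ ((x - v * t) / Λ) * (1 / Λ) := by
  funext x t
  exact ((hg _).comp x (((hasDerivAt_id x).sub_const (v * t)).div_const Λ)).deriv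

lemma pd2_travelling {g g₁ : ℝ → ℝ} (hg : ∀ y, HasDerivAt g (g₁ y) y) (v Λ : ℝ) :
    pd2 (fun x t => g ((x - v * t) / Λ)) = fun x t => g₁ ((x - v * t) / Λ) * (-v / Λ) := by
  funext x t
  have h := (((hasDerivAt_id t).const_mul v).const_sub x).div_const Λ
  simpa [pd2, Function.comp_def] using ((hg _).comp t h).deriv

lemma pd1_pd1_travelling {g g₁ g₂ : ℝ → ℝ} (hg : ∀ y, HasDerivAt g (g₁ y) y)
    (hg₁ : ∀ y, HasDerivAt g₁ (g₂ y) y) (v Λ : ℝ) :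
    pd1 (pd1 (fun x t => g ((x - v * t) / Λ))) =
      fun x t => g₂ ((x - v * t) / Λ) * (1 / Λ) * (1 / Λ) := by
  rw [pd1_travelling hg]
  exact pd1_travelling (fun y => (hg₁ y).mul_const (1 / Λ)) v Λ

lemma pd2_pd2_travelling {g g₁ g₂ : ℝ → ℝ} (hg : ∀ y, HasDerivAt g (g₁ y) y)
    (hg₁ : ∀ y, HasDerivAt g₁ (g₂ y) y) (v Λ : ℝ) :
    pd2 (pd2 (fun x t => g ((x - v * t) / Λ))) =
      fun x t => g₂ ((x - v * t) / Λ) * (-v / Λ) * (-v / Λ) := by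
  rw [pd2_travelling hg]
  exact pd2_travelling (fun y => (hg₁ y).mul_const (-v / Λ)) v Λ

/-- The travelling wave `u(x,t) = A sech²((x − v t)/Λ)` with `A = 12 v²/Λ²` and
`v² = Λ²/(Λ² − 4ε)` is an exact solution of the regularised Boussinesq equation
`u_tt − u_xx = ε[ (1/2)(u²)_xx + u_ttxx ]` at every point of `ℝ²`.
Here the function `u x t` has first argument `x` (space) and second argument `t` (time). -/
theorem stmt0 (ε Λ v : ℝ) (hε : 0 < ε) (hΛ : 0 < Λ) (h4 : Λ ^ 2 > 4 * ε)
    (hv : v ^ 2 = Λ ^ 2 / (Λ ^ 2 - 4 * ε))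
    (A : ℝ) (hA : A = 12 * v ^ 2 / Λ ^ 2)
    (u : ℝ → ℝ → ℝ)
    (hu : ∀ x t, u x t = A * (1 / Real.cosh ((x - v * t) / Λ)) ^ 2) :
    ∀ x t : ℝ,
      pd2 (pd2 u) x t - pd1 (pd1 u) x t
        = ε * ((1 / 2) * pd1 (pd1 (fun x t => (u x t) ^ 2)) x t
            + pd1 (pd1 (pd2 (pd2 u))) x t) := by
  intro x t
  have hd : Λ ^ 2 - 4 * ε ≠ 0 := by linarith
  have hΛ0 : Λ ≠ 0 := hΛ.ne'
  have hrel : v ^ 2 * (Λ ^ 2 - 4 * ε) = Λ ^ 2 := by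
    rw [hv]
    field_simp
  obtain rfl : u = fun x t => A * (1 / Real.cosh ((x - v * t) / Λ)) ^ 2 := by
    funext x t
    exact hu x t
  have hsq : (fun x t : ℝ => (A * (1 / Real.cosh ((x - v * t) / Λ)) ^ 2) ^ 2) =
      fun x t => A ^ 2 * (1 / Real.cosh ((x - v * t) / Λ)) ^ 4 := by
    funext x t
    ring
  have profile (n : ℕ) (a y : ℝ) := (hasDerivAt_sech_pow n y).const_mul a
  have profile_deriv (n : ℕ) (a y : ℝ) := (hasDerivAt_deriv_sech_pow n y).const_mul a
  have htt := pd2_pd2_travelling (profile 2 A) (profile_deriv 2 A) v Λ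
  have hxx := pd1_pd1_travelling (profile 2 A) (profile_deriv 2 A) v Λ
  have hsqxx := pd1_pd1_travelling (profile 4 (A ^ 2)) (profile_deriv 4 (A ^ 2)) v Λ
  have httxx := pd1_pd1_travelling
    (fun y => ((((hasDerivAt_sech_pow 2 y).const_mul (((2 : ℕ) : ℝ) ^ 2)).sub
      ((hasDerivAt_sech_pow (2 + 2) y).const_mul (((2 : ℕ) : ℝ) * ((2 : ℕ) + 1)))).const_mul
        A).mul_const (-v / Λ) |>.mul_const (-v / Λ))
    (fun y => ((((hasDerivAt_deriv_sech_pow 2 y).const_mul (((2 : ℕ) : ℝ) ^ 2)).sub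
      ((hasDerivAt_deriv_sech_pow (2 + 2) y).const_mul
        (((2 : ℕ) : ℝ) * ((2 : ℕ) + 1)))).const_mul A).mul_const (-v / Λ) |>.mul_const (-v / Λ))
    v Λ
  simp only [Pi.sub_apply] at httxx
  rw [hsq, htt, hxx, hsqxx, httxx]
  beta_reduce
  generalize 1 / Real.cosh ((x - v * t) / Λ) = s
  subst hA
  push_cast
  field_simp
  linear_combination v ^ 2 * (8 * s ^ 2 - 12 * s ^ 4) * hrel
end

section
/- Let L > 0 and let α, β, γ, δ, c, ε be real constants. Suppose u, w : ℝ × ℝ → ℝ are four times continuously differentiable, are 2L-periodic in the spatial variable x for every t, and satisfy the cRB system at every point. Define the mean values ū(t) = (1/2L)∫_{−L}^{L} u(x,t) dx and w̄(t) = (1/2L)∫_{−L}^{L} w(x,t) dx. Then ū and w̄ are twice differentiable and satisfy the ODE system ū''(t) = −ε δ (ū(t) − w̄(t)) and w̄''(t) = ε γ (ū(t) − w̄(t)) for all t. -/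
/-- The coupled regularised Boussinesq (cRB) system:
`u_tt − u_xx = ε[ (1/2)(u²)_xx + u_ttxx − δ(u − w) ]`,
`w_tt − c² w_xx = ε[ (α/2)(w²)_xx + β w_ttxx + γ(u − w) ]`. -/
def cRB (α β γ δ c ε : ℝ) (u w : ℝ → ℝ → ℝ) : Prop :=
  ∀ x t : ℝ,
    pd2 (pd2 u) x t - pd1 (pd1 u) x t
      = ε * ((1 / 2) * pd1 (pd1 (fun x t => (u x t) ^ 2)) x t
          + pd1 (pd1 (pd2 (pd2 u))) x t - δ * (u x t - w x t)) ∧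
    pd2 (pd2 w) x t - c ^ 2 * pd1 (pd1 w) x t
      = ε * ((α / 2) * pd1 (pd1 (fun x t => (w x t) ^ 2)) x t
          + β * pd1 (pd1 (pd2 (pd2 w))) x t + γ * (u x t - w x t))

open Function Set

section PartialDerivatives

variable {f : ℝ → ℝ → ℝ}

theorem hasDerivAt_fst_of_contDiff (hf : ContDiff ℝ 1 (uncurry f)) (x t : ℝ) :
    HasDerivAt (fun x' => f x' t) (fderiv ℝ (uncurry f) (x, t) (1, 0)) x :=
  HasFDerivAt.comp_hasDerivAt (l := uncurry f) (f := fun x' : ℝ => (x', t)) x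
    (hf.differentiable one_ne_zero (x, t)).hasFDerivAt
    ((hasDerivAt_id x).prodMk (hasDerivAt_const x t))

theorem hasDerivAt_snd_of_contDiff (hf : ContDiff ℝ 1 (uncurry f)) (x t : ℝ) :
    HasDerivAt (fun t' => f x t') (fderiv ℝ (uncurry f) (x, t) (0, 1)) t :=
  HasFDerivAt.comp_hasDerivAt (l := uncurry f) (f := fun t' : ℝ => (x, t')) t
    (hf.differentiable one_ne_zero (x, t)).hasFDerivAt
    ((hasDerivAt_const t x).prodMk (hasDerivAt_id t))

theorem hasDerivAt_pd1 (hf : ContDiff ℝ 1 (uncurry f)) (x t : ℝ) :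
    HasDerivAt (fun x' => f x' t) (pd1 f x t) x :=
  (hasDerivAt_fst_of_contDiff hf x t).differentiableAt.hasDerivAt

theorem hasDerivAt_pd2 (hf : ContDiff ℝ 1 (uncurry f)) (x t : ℝ) :
    HasDerivAt (fun t' => f x t') (pd2 f x t) t :=
  (hasDerivAt_snd_of_contDiff hf x t).differentiableAt.hasDerivAt

theorem contDiff_pd1 {n : ℕ} (hf : ContDiff ℝ (n + 1) (uncurry f)) :
    ContDiff ℝ n (uncurry (pd1 f)) := by
  have h : uncurry (pd1 f) = fun p => fderiv ℝ (uncurry f) p (1, 0) := by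
    ext ⟨x, t⟩
    exact (hasDerivAt_fst_of_contDiff (hf.of_le le_add_self) x t).deriv
  rw [h]
  exact (hf.fderiv_right le_rfl).clm_apply contDiff_const

theorem contDiff_pd2 {n : ℕ} (hf : ContDiff ℝ (n + 1) (uncurry f)) :
    ContDiff ℝ n (uncurry (pd2 f)) := by
  have h : uncurry (pd2 f) = fun p => fderiv ℝ (uncurry f) p (0, 1) := by
    ext ⟨x, t⟩
    exact (hasDerivAt_snd_of_contDiff (hf.of_le le_add_self) x t).deriv
  rw [h]
  exact (hf.fderiv_right le_rfl).clm_apply contDiff_const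

theorem pd1_add_period {T : ℝ} (hf : ∀ x t, f (x + T) t = f x t) (x t : ℝ) :
    pd1 f (x + T) t = pd1 f x t := by
  rw [pd1, pd1, ← deriv_comp_add_const]
  simp only [hf]

theorem pd2_add_period {T : ℝ} (hf : ∀ x t, f (x + T) t = f x t) (x t : ℝ) :
    pd2 f (x + T) t = pd2 f x t := by
  simp only [pd2, hf]

theorem continuous_slice (hf : Continuous (uncurry f)) (t : ℝ) :
    Continuous fun x => f x t :=
  hf.comp (Continuous.prodMk_left t)

theorem continuous_pd1_pd1 (hf : ContDiff ℝ 2 (uncurry f)) :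
    Continuous (uncurry (pd1 (pd1 f))) := by
  have h : ContDiff ℝ 1 (uncurry (pd1 f)) := contDiff_pd1 (n := 1) hf
  exact (contDiff_pd1 (n := 0) (by simpa using h)).continuous

/-- Second `x`-derivatives of functions periodic in `x` have zero mean. -/
theorem integral_pd1_pd1_eq_zero {L : ℝ} (hf : ContDiff ℝ 2 (uncurry f))
    (hp : ∀ x t, f (x + 2 * L) t = f x t) (t : ℝ) :
    ∫ x in (-L)..L, pd1 (pd1 f) x t = 0 := by
  have h1 : ContDiff ℝ 1 (uncurry (pd1 f)) := contDiff_pd1 (n := 1) hf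
  rw [intervalIntegral.integral_eq_sub_of_hasDerivAt (fun x _ => hasDerivAt_pd1 h1 x t)
    ((continuous_slice (continuous_pd1_pd1 hf) t).intervalIntegrable _ _)]
  have h := pd1_add_period hp (-L) t
  rw [show -L + 2 * L = L by ring] at h
  rw [h, sub_self]

/-- Differentiation under the integral sign for `C¹` functions on a compact interval. -/
theorem hasDerivAt_integral_of_contDiff (hf : ContDiff ℝ 1 (uncurry f)) (a b t : ℝ) :
    HasDerivAt (fun t => ∫ x in a..b, f x t) (∫ x in a..b, pd2 f x t) t := by
  have hc : Continuous (uncurry (pd2 f)) :=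
    (contDiff_pd2 (n := 0) (by simpa using hf)).continuous
  obtain ⟨C, hC⟩ := (isCompact_uIcc.prod (isCompact_closedBall t 1)).exists_bound_of_continuousOn
    (s := uIcc a b ×ˢ Metric.closedBall t 1) hc.continuousOn
  refine (intervalIntegral.hasDerivAt_integral_of_dominated_loc_of_deriv_le
    (F := fun t x => f x t) (F' := fun t x => pd2 f x t) (bound := fun _ => C)
    (Metric.closedBall_mem_nhds t one_pos)
    (.of_forall fun s => (continuous_slice hf.continuous s).aestronglyMeasurable)
    ((continuous_slice hf.continuous t).intervalIntegrable _ _)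
    (continuous_slice hc t).aestronglyMeasurable
    (.of_forall fun x hx s hs => hC (x, s) ⟨uIoc_subset_uIcc hx, hs⟩)
    intervalIntegrable_const
    (.of_forall fun x _ s _ => hasDerivAt_pd2 hf x s)).2

end PartialDerivatives

/-- The mean of a periodic solution of a single forced regularised Boussinesq equation is
twice differentiable, with second derivative the mean of the forcing. -/
theorem mean_of_forced_boussinesq {L a b k : ℝ} {u g : ℝ → ℝ → ℝ}
    (hu : ContDiff ℝ 4 (uncurry u)) (hg : Continuous (uncurry g))
    (hp : ∀ x t, u (x + 2 * L) t = u x t)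
    (heq : ∀ x t, pd2 (pd2 u) x t = a * pd1 (pd1 u) x t
      + b * pd1 (pd1 (fun x t => (u x t) ^ 2)) x t
      + k * pd1 (pd1 (pd2 (pd2 u))) x t + g x t)
    {m : ℝ → ℝ} (hm : ∀ t, m t = (1 / (2 * L)) * ∫ x in (-L)..L, u x t) :
    (∀ t, DifferentiableAt ℝ m t) ∧
    ∀ t, HasDerivAt (deriv m) ((1 / (2 * L)) * ∫ x in (-L)..L, g x t) t := by
  have ht : ContDiff ℝ 3 (uncurry (pd2 u)) := contDiff_pd2 (n := 3) hu
  have htt : ContDiff ℝ 2 (uncurry (pd2 (pd2 u))) := contDiff_pd2 (n := 2) ht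
  have hu2 : ContDiff ℝ 2 (uncurry u) := hu.of_le (by norm_num)
  have hsq : ContDiff ℝ 2 (uncurry fun x t => (u x t) ^ 2) := hu2.pow 2
  have hint : ∀ {f : ℝ → ℝ → ℝ}, ContDiff ℝ 2 (uncurry f) → ∀ r t : ℝ,
      IntervalIntegrable (fun x => r * pd1 (pd1 f) x t) MeasureTheory.volume (-L) L :=
    fun hf r t => ((continuous_slice (continuous_pd1_pd1 hf) t).const_mul r).intervalIntegrable _ _
  have hm' : ∀ t, HasDerivAt m ((1 / (2 * L)) * ∫ x in (-L)..L, pd2 u x t) t := by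
    intro t
    rw [funext hm]
    exact (hasDerivAt_integral_of_contDiff (hu.of_le (by norm_num)) _ _ t).const_mul _
  refine ⟨fun t => (hm' t).differentiableAt, fun t => ?_⟩
  have hmean : ∫ x in (-L)..L, pd2 (pd2 u) x t = ∫ x in (-L)..L, g x t := by
    simp only [heq]
    rw [intervalIntegral.integral_add
        (((hint hu2 a t).add (hint hsq b t)).add (hint htt k t))
        ((continuous_slice hg t).intervalIntegrable _ _),
      intervalIntegral.integral_add ((hint hu2 a t).add (hint hsq b t)) (hint htt k t),
      intervalIntegral.integral_add (hint hu2 a t) (hint hsq b t)]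
    simp only [intervalIntegral.integral_const_mul]
    rw [integral_pd1_pd1_eq_zero hu2 hp, integral_pd1_pd1_eq_zero hsq (by simp [hp]),
      integral_pd1_pd1_eq_zero htt (pd2_add_period (pd2_add_period hp))]
    ring
  rw [funext fun t => (hm' t).deriv, ← hmean]
  exact (hasDerivAt_integral_of_contDiff (ht.of_le (by norm_num)) _ _ t).const_mul _

/-- For `2L`-periodic (in `x`) C⁴ solutions of the cRB system, the mean values
`ū(t) = (1/2L)∫_{−L}^{L} u dx`, `w̄(t) = (1/2L)∫_{−L}^{L} w dx` are twice
differentiable and satisfy `ū'' = −εδ(ū − w̄)`, `w̄'' = εγ(ū − w̄)`. -/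
theorem stmt1 (L α β γ δ c ε : ℝ) (hL : 0 < L) (u w : ℝ → ℝ → ℝ)
    (hu : ContDiff ℝ 4 (Function.uncurry u)) (hw : ContDiff ℝ 4 (Function.uncurry w))
    (hup : ∀ x t, u (x + 2 * L) t = u x t) (hwp : ∀ x t, w (x + 2 * L) t = w x t)
    (hsys : cRB α β γ δ c ε u w)
    (ubar wbar : ℝ → ℝ)
    (hub : ∀ t, ubar t = (1 / (2 * L)) * ∫ x in (-L)..L, u x t)
    (hwb : ∀ t, wbar t = (1 / (2 * L)) * ∫ x in (-L)..L, w x t) :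
    (∀ t, DifferentiableAt ℝ ubar t) ∧ (∀ t, DifferentiableAt ℝ wbar t) ∧
    (∀ t, HasDerivAt (deriv ubar) (-(ε * δ) * (ubar t - wbar t)) t) ∧
    (∀ t, HasDerivAt (deriv wbar) (ε * γ * (ubar t - wbar t)) t) := by
  have hdiff : ∀ r t : ℝ, (1 / (2 * L)) * ∫ x in (-L)..L, r * (u x t - w x t)
      = r * (ubar t - wbar t) := by
    intro r t
    rw [intervalIntegral.integral_const_mul, intervalIntegral.integral_sub
      ((continuous_slice hu.continuous t).intervalIntegrable _ _)
      ((continuous_slice hw.continuous t).intervalIntegrable _ _), hub, hwb]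
    ring
  obtain ⟨hu1, hu2⟩ := mean_of_forced_boussinesq (a := 1) (b := ε * (1 / 2)) (k := ε)
    (g := fun x t => -(ε * δ) * (u x t - w x t)) hu
    (continuous_const.mul (hu.continuous.sub hw.continuous)) hup
    (fun x t => by linear_combination (hsys x t).1) hub
  obtain ⟨hw1, hw2⟩ := mean_of_forced_boussinesq (a := c ^ 2) (b := ε * (α / 2)) (k := ε * β)
    (g := fun x t => ε * γ * (u x t - w x t)) hw
    (continuous_const.mul (hu.continuous.sub hw.continuous)) hwp
    (fun x t => by linear_combination (hsys x t).2) hwb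
  simp only [hdiff] at hu2 hw2
  exact ⟨hu1, hw1, hu2, hw2⟩
end

section
/- Let α, β, γ, δ, c be real constants, let ε > 0 with δ + γ > 0, and set ω = √(ε(δ + γ)). Let d₁, d₂ be real constants and define ū(t) = d₁ + δ d₂ cos(ωt) and w̄(t) = d₁ − γ d₂ cos(ωt). Suppose u, w : ℝ × ℝ → ℝ are four times continuously differentiable and satisfy the cRB system at every point. Then the deviations ũ(x,t) = u(x,t) − ū(t) and w̃(x,t) = w(x,t) − w̄(t) satisfy the variable-coefficient system ũ_tt − ũ_xx = ε[ (1/2)(ũ²)_xx + (d₁ + δ d₂ cos(ωt)) ũ_xx + ũ_ttxx − δ(ũ − w̃) ] and w̃_tt − c² w̃_xx = ε[ (α/2)(w̃²)_xx + α(d₁ − γ d₂ cos(ωt)) w̃_xx + β w̃_ttxx + γ(ũ − w̃) ] at every point. -/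
lemma contDiff_slice_fst {n : WithTop ℕ∞} {f : ℝ → ℝ → ℝ}
    (hf : ContDiff ℝ n (Function.uncurry f)) (t : ℝ) : ContDiff ℝ n (fun x => f x t) :=
  hf.comp (contDiff_id.prodMk contDiff_const)

lemma contDiff_slice_snd {n : WithTop ℕ∞} {f : ℝ → ℝ → ℝ}
    (hf : ContDiff ℝ n (Function.uncurry f)) (x : ℝ) : ContDiff ℝ n (fun t => f x t) :=
  hf.comp (contDiff_const.prodMk contDiff_id)

lemma pd1_sub_time (f : ℝ → ℝ → ℝ) (m : ℝ → ℝ) :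
    pd1 (fun x t => f x t - m t) = pd1 f := by
  funext x t
  simp only [pd1, deriv_sub_const]

lemma pd2_pd2_sub_time {f : ℝ → ℝ → ℝ} (hf : ContDiff ℝ 2 (Function.uncurry f))
    {m : ℝ → ℝ} (hm : ContDiff ℝ 2 m) :
    pd2 (pd2 (fun x t => f x t - m t)) =
      fun x t => pd2 (pd2 f) x t - deriv (deriv m) t := by
  funext x t
  have hfx := contDiff_slice_snd hf x
  have h : (fun t => pd2 (fun x t => f x t - m t) x t) =
      fun t => deriv (fun t => f x t) t - deriv m t := by
    funext s
    exact deriv_fun_sub (hfx.differentiable (by norm_num) s) (hm.differentiable (by norm_num) s)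
  rw [pd2, h]
  exact deriv_fun_sub (hfx.differentiable_deriv_two t) (hm.differentiable_deriv_two t)

/-- `((f - m)²)_xx = (f²)_xx - 2 m f_xx` for `m` independent of `x`. -/
lemma pd1_pd1_sub_time_sq {f : ℝ → ℝ → ℝ} (hf : ContDiff ℝ 2 (Function.uncurry f))
    (m : ℝ → ℝ) (x t : ℝ) :
    pd1 (pd1 (fun x t => (f x t - m t) ^ 2)) x t =
      pd1 (pd1 (fun x t => f x t ^ 2)) x t - 2 * m t * pd1 (pd1 f) x t := by
  have hft := contDiff_slice_fst hf t
  have hd : Differentiable ℝ (fun x => f x t) := hft.differentiable (by norm_num)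
  have h : (fun y => pd1 (fun x t => (f x t - m t) ^ 2) y t) =
      fun y => deriv (fun x => f x t ^ 2) y - 2 * m t * deriv (fun x => f x t) y := by
    funext y
    have e : (fun x => (f x t - m t) ^ 2) =
        fun x => f x t ^ 2 - 2 * m t * f x t + m t ^ 2 := by
      funext x
      ring
    rw [pd1, e, deriv_add_const,
      deriv_fun_sub ((hd y).fun_pow 2) ((hd y).const_mul _), deriv_const_mul _ (hd y)]
  have hd' : DifferentiableAt ℝ (deriv fun x => f x t) x := hft.differentiable_deriv_two x
  have hs : DifferentiableAt ℝ (deriv fun x => f x t ^ 2) x :=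
    (hft.pow 2).differentiable_deriv_two x
  rw [pd1, h, deriv_fun_sub hs (hd'.const_mul _), deriv_const_mul _ hd']
  rfl

lemma deriv_deriv_add_mul_cos (a b ω t : ℝ) :
    deriv (deriv fun t => a + b * Real.cos (ω * t)) t = -(b * ω ^ 2 * Real.cos (ω * t)) := by
  have hl (s : ℝ) : HasDerivAt (fun t => ω * t) ω s := by
    simpa using (hasDerivAt_id s).const_mul ω
  have h : deriv (fun t => a + b * Real.cos (ω * t)) =
      fun s => b * (-Real.sin (ω * s) * ω) := by
    funext s
    exact (((hl s).cos.const_mul b).const_add a).deriv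
  rw [h, (((hl t).sin.fun_neg.mul_const ω).const_mul b).deriv]
  ring

/-- If `u, w` are C⁴ solutions of the cRB system, then the deviations
`ũ = u − ū`, `w̃ = w − w̄` from the oscillating means `ū(t) = d₁ + δd₂cos(ωt)`,
`w̄(t) = d₁ − γd₂cos(ωt)`, with `ω = √(ε(δ+γ))`, satisfy the variable-coefficient
system
`ũ_tt − ũ_xx = ε[ (1/2)(ũ²)_xx + (d₁ + δd₂cos(ωt)) ũ_xx + ũ_ttxx − δ(ũ − w̃) ]`,
`w̃_tt − c²w̃_xx = ε[ (α/2)(w̃²)_xx + α(d₁ − γd₂cos(ωt)) w̃_xx + β w̃_ttxx + γ(ũ − w̃) ]`. -/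
theorem stmt4 (α β γ δ c ε : ℝ) (hε : 0 < ε) (hdg : 0 < δ + γ)
    (ω d1 d2 : ℝ) (hω : ω = Real.sqrt (ε * (δ + γ)))
    (u w : ℝ → ℝ → ℝ)
    (hu : ContDiff ℝ 4 (Function.uncurry u)) (hw : ContDiff ℝ 4 (Function.uncurry w))
    (hsys : cRB α β γ δ c ε u w)
    (ut wt : ℝ → ℝ → ℝ)
    (hut : ∀ x t, ut x t = u x t - (d1 + δ * d2 * Real.cos (ω * t)))
    (hwt : ∀ x t, wt x t = w x t - (d1 - γ * d2 * Real.cos (ω * t))) :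
    ∀ x t : ℝ,
      (pd2 (pd2 ut) x t - pd1 (pd1 ut) x t
        = ε * ((1 / 2) * pd1 (pd1 (fun x t => (ut x t) ^ 2)) x t
            + (d1 + δ * d2 * Real.cos (ω * t)) * pd1 (pd1 ut) x t
            + pd1 (pd1 (pd2 (pd2 ut))) x t - δ * (ut x t - wt x t))) ∧
      (pd2 (pd2 wt) x t - c ^ 2 * pd1 (pd1 wt) x t
        = ε * ((α / 2) * pd1 (pd1 (fun x t => (wt x t) ^ 2)) x t
            + α * (d1 - γ * d2 * Real.cos (ω * t)) * pd1 (pd1 wt) x t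
            + β * pd1 (pd1 (pd2 (pd2 wt))) x t + γ * (ut x t - wt x t))) := by
  have hω2 : ω ^ 2 = ε * (δ + γ) := by
    rw [hω, Real.sq_sqrt (mul_pos hε hdg).le]
  have hu2 : ContDiff ℝ 2 (Function.uncurry u) := hu.of_le (by norm_num)
  have hw2 : ContDiff ℝ 2 (Function.uncurry w) := hw.of_le (by norm_num)
  have hm (b : ℝ) : ContDiff ℝ 2 (fun t => d1 + b * Real.cos (ω * t)) := by fun_prop
  obtain rfl : ut = fun x t => u x t - (d1 + δ * d2 * Real.cos (ω * t)) := by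
    funext x t
    exact hut x t
  obtain rfl : wt = fun x t => w x t - (d1 + -(γ * d2) * Real.cos (ω * t)) := by
    funext x t
    rw [hwt x t]
    ring
  intro x t
  obtain ⟨h1, h2⟩ := hsys x t
  rw [pd2_pd2_sub_time hu2 (hm _), pd2_pd2_sub_time hw2 (hm _),
    pd1_sub_time u fun t => d1 + δ * d2 * Real.cos (ω * t),
    pd1_sub_time w fun t => d1 + -(γ * d2) * Real.cos (ω * t),
    pd1_sub_time (pd2 (pd2 u)), pd1_sub_time (pd2 (pd2 w)),
    pd1_pd1_sub_time_sq hu2 fun t => d1 + δ * d2 * Real.cos (ω * t),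
    pd1_pd1_sub_time_sq hw2 fun t => d1 + -(γ * d2) * Real.cos (ω * t)]
  simp only [deriv_deriv_add_mul_cos, hω2]
  constructor
  · linear_combination h1
  · linear_combination h2
end
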